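/- For all integers i ≥ 0, k ≥ 0 and q ≥ 1, v_{k·2^q + i} ≡ v_i (mod 2^q); moreover for q ≥ 2, v_{2^{q-1} + i} ≡ v_i + 2^{q-1} (mod 2^q). Consequently, for each q ≥ 1 and each odd residue a mod 2^q, there are exactly two indices 1 ≤ j ≤ 2^q with v_j ≡ a (mod 2^q). -/

import Mathlib

open Polynomial Finset

noncomputable def v (n : ℕ) : ℤ :=
  if n = 0 then -1 else
  ((1 - X) * ∏ j ∈ Finset.range (2 * n - 2),
      (C ((2 * n : ℤ) - 3 - (j : ℤ)) + C (j : ℤ) * X)).coeff (n - 1)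

theorem dvd_prod_sub_prod {ι A : Type*} [CommRing A] {a : A} (s : Finset ι) {f g : ι → A}
    (h : ∀ i ∈ s, a ∣ f i - g i) : a ∣ ∏ i ∈ s, f i - ∏ i ∈ s, g i := by
  classical
  induction s using Finset.induction_on with
  | empty => simp
  | insert i s hi ih =>
    rw [Finset.prod_insert hi, Finset.prod_insert hi]
    have h₁ := ih fun j hj => h j (Finset.mem_insert_of_mem hj)
    have h₂ := h i (Finset.mem_insert_self i s)
    have := dvd_add (h₁.mul_left (f i)) (h₂.mul_right (∏ j ∈ s, g j))
    convert this using 1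
    ring

theorem exists_prod_mul_add_eq {A : Type*} [CommRing A] (w b : A) (z : ℕ → A) (n : ℕ) :
    ∃ c z' : A, ∏ s ∈ Finset.range n, (1 + 2 * z s) = 1 + 2 * z' ∧
      ∏ s ∈ Finset.range n, (1 + 2 * z s + 2 * b * w) * (1 + 2 * z s) =
      (∏ s ∈ Finset.range n, (1 + 2 * z s)) ^ 2 + n * (2 * b * w) + 4 * b * c := by
  induction n with
  | zero => exact ⟨0, 0, by simp, by simp⟩
  | succ n ih =>
    obtain ⟨c, z', h₁, h₂⟩ := ih
    simp only [Finset.prod_range_succ, h₂, h₁]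
    generalize z n = x
    refine ⟨w * (x + 2 * z' * (1 + z') * (1 + 2 * x)) + n * w * (2 * x + 2 * x ^ 2) +
      n * b * w ^ 2 * (1 + 2 * x) + c * ((1 + 2 * x + 2 * b * w) * (1 + 2 * x)), z' + x + 2 * z' * x, ?_, ?_⟩
    · ring
    · push_cast; ring

theorem exists_prod_range_two_pow_eq {A : Type*} [CommRing A] (w : A) (e : ℤ) (r : ℕ) :
    ∃ c : A, ∏ s ∈ Finset.range (2 ^ (r + 2)), ((1 + 4 * e : A) + 2 * s * w) =
      1 + 2 ^ (r + 2) * (w + w ^ 2) + 2 ^ (r + 3) * c := by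
  induction r with
  | zero =>
    simp [Finset.prod_range_succ]
    refine ⟨2 * e + 12 * e ^ 2 + 32 * e ^ 3 + 32 * e ^ 4 +
      w * (1 + 18 * e + 72 * e ^ 2 + 96 * e ^ 3) + w ^ 2 * (5 + 44 * e + 88 * e ^ 2) +
      6 * (1 + 4 * e) * w ^ 3, ?_⟩
    ring
  | succ r ih =>
    obtain ⟨c, hc⟩ := ih
    obtain ⟨c', -, -, h⟩ := exists_prod_mul_add_eq w (2 ^ (r + 2)) (fun s => 2 * (e : A) + s * w)
      (2 ^ (r + 2))
    have h₀ : ∀ s : ℕ, (1 + 4 * e : A) + 2 * s * w = 1 + 2 * (2 * (e : A) + s * w) := by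
      intro s; ring
    simp only [← h₀] at h
    rw [hc] at h
    have h₁ : (2 : ℕ) ^ (r + 1 + 2) = 2 ^ (r + 2) + 2 ^ (r + 2) := by ring
    rw [h₁, Finset.prod_range_add, mul_comm, ← Finset.prod_mul_distrib]
    have h₂ : ∀ s : ℕ, (1 + 4 * e : A) + 2 * ((2 ^ (r + 2) + s : ℕ) : A) * w =
        (1 + 4 * e : A) + 2 * s * w + 2 * 2 ^ (r + 2) * w := by
      intro s; push_cast; ring
    simp only [h₂, h]
    refine ⟨2 ^ r * ((w + w ^ 2) + 2 * c) ^ 2 + c + 2 ^ (r + 1) * w + c', ?_⟩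
    push_cast
    ring

theorem eq_of_two_pow_dvd_mul_succ_sub {r t t' : ℕ} (ht : t < 2 ^ r) (ht' : t' < 2 ^ r)
    (h : (2 : ℤ) ^ (r + 1) ∣ t * (t + 1) - t' * (t' + 1)) : t = t' := by
  have hfac : (t * (t + 1) - t' * (t' + 1) : ℤ) = (t - t') * (t + t' + 1) := by ring
  rw [hfac] at h
  have hpow : (2 : ℤ) ^ (r + 1) = 2 * 2 ^ r := by ring
  zify at ht ht'
  have hcop {x : ℤ} (hx : Odd x) : IsCoprime ((2 : ℤ) ^ (r + 1)) x :=
    (Int.isCoprime_two_left.2 hx).pow_left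
  rcases Int.even_or_odd ((t : ℤ) - t') with he | ho
  · have ho' : Odd ((t : ℤ) + t' + 1) := by grind
    have h₁ := (hcop ho').dvd_of_dvd_mul_right h
    have := Int.eq_zero_of_abs_lt_dvd h₁ (by rw [abs_lt]; constructor <;> linarith)
    omega
  · have h₁ := (hcop ho).dvd_of_dvd_mul_left h
    have := Int.le_of_dvd (by positivity) h₁
    linarith

theorem two_pow_dvd_prod_sub_prod {A : Type*} [CommRing A] (w d : A) (M : ℤ) (r : ℕ) :
    (2 : A) ^ (r + 1) ∣ ∏ t ∈ Finset.range (2 ^ r), (d + ((M + t) * (M - 1 - t) : ℤ) * w) -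
      ∏ s ∈ Finset.range (2 ^ r), (d + 2 * s * w) := by
  have heven (t : ℕ) : 2 ∣ (M + t) * (M - 1 - t) := by
    rw [← even_iff_two_dvd]; grind
  choose u hu using heven
  have hpos : (0 : ℤ) < 2 ^ r := by positivity
  set σ : ℕ → ℕ := fun t => (u t % 2 ^ r).toNat with hσ
  have hσ_cast (t : ℕ) : (σ t : ℤ) = u t % 2 ^ r :=
    Int.toNat_of_nonneg (Int.emod_nonneg _ hpos.ne')
  have hmaps : Set.MapsTo σ (Finset.range (2 ^ r)) (Finset.range (2 ^ r)) := by
    intro t _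
    rw [Finset.mem_coe, Finset.mem_range]
    zify
    rw [hσ_cast]
    exact Int.emod_lt_of_pos _ hpos
  have hinj : Set.InjOn σ (Finset.range (2 ^ r)) := by
    intro t ht t' ht' heq
    rw [Finset.mem_coe, Finset.mem_range] at ht ht'
    have h₁ : u t' % 2 ^ r = u t % 2 ^ r := by rw [← hσ_cast, ← hσ_cast, heq]
    obtain ⟨k, hk⟩ := Int.ModEq.dvd h₁
    refine eq_of_two_pow_dvd_mul_succ_sub ht ht' ⟨-k, ?_⟩
    linear_combination hu t' - hu t - 2 * hk
  have hbij : ∏ s ∈ Finset.range (2 ^ r), (d + 2 * s * w) =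
      ∏ t ∈ Finset.range (2 ^ r), (d + 2 * (σ t : A) * w) :=
    (Finset.prod_nbij σ hmaps hinj
      (Finset.surjOn_of_injOn_of_card_le σ hmaps hinj le_rfl) fun _ _ => rfl).symm
  rw [hbij]
  refine dvd_prod_sub_prod _ fun t _ => ⟨(u t / 2 ^ r : ℤ) * w, ?_⟩
  have h₁ : (σ t : A) = ((u t : ℤ) : A) - 2 ^ r * (u t / 2 ^ r : ℤ) := by
    rw [← Int.cast_natCast, hσ_cast, Int.emod_def]
    push_cast; ring
  rw [hu, h₁]
  push_cast
  ring

theorem exists_prod_range_two_pow_eq_of_pos {A : Type*} [CommRing A] (w : A) (e M : ℤ) {r : ℕ}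
    (hr : 1 ≤ r) :
    ∃ (n : ℤ) (c : A), ∏ t ∈ Finset.range (2 ^ r),
      ((1 + 4 * e : A) + ((M + t) * (M - 1 - t) : ℤ) * w) =
      1 + 2 ^ r * (w + n * w ^ 2) + 2 ^ (r + 1) * c := by
  obtain ⟨k, hk⟩ := two_pow_dvd_prod_sub_prod w (1 + 4 * e : A) M r
  rw [sub_eq_iff_eq_add] at hk
  rw [hk]
  obtain _ | _ | r := r
  · omega
  · refine ⟨0, k + (2 * e + 4 * e ^ 2 + 2 * e * w), ?_⟩
    simp [Finset.prod_range_succ]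
    ring
  · obtain ⟨c, hc⟩ := exists_prod_range_two_pow_eq w e r
    refine ⟨1, k + c, ?_⟩
    rw [hc]
    push_cast
    ring

section LaurentFunctional

open scoped LaurentPolynomial

open LaurentPolynomial (T)

/-- The polynomial `T + T⁻¹ - 2 = (1 - T)² / T`. -/
noncomputable def laurentW : ℤ[T;T⁻¹] := T 1 + T (-1) - 2

/-- The constant coefficient of `(1 - T) * f`. -/
noncomputable def lam : ℤ[T;T⁻¹] →+ ℤ where
  toFun f := ((1 - T 1) * f).coeff 0
  map_zero' := by simp
  map_add' f g := by simp [mul_add]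

theorem lam_apply (f : ℤ[T;T⁻¹]) : lam f = ((1 - T 1) * f).coeff 0 := rfl

theorem lam_intCast_mul (n : ℤ) (f : ℤ[T;T⁻¹]) : lam (n * f) = n * lam f := by
  rw [← zsmul_eq_mul, map_zsmul, smul_eq_mul]

theorem lam_two_pow_mul (k : ℕ) (f : ℤ[T;T⁻¹]) : lam (2 ^ k * f) = 2 ^ k * lam f := by
  have := lam_intCast_mul (2 ^ k) f
  push_cast at this
  exact this

theorem T_one_mul_T_neg_one : (T 1 * T (-1) : ℤ[T;T⁻¹]) = 1 := by
  rw [← LaurentPolynomial.T_add]; simp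

theorem lam_one : lam 1 = 1 := by
  rw [lam_apply, mul_one, ← LaurentPolynomial.T_zero]
  simp [LaurentPolynomial.T_apply]

theorem lam_laurentW : lam laurentW = -3 := by
  have h : (1 - T 1) * laurentW =
      T (-1) + T 1 + T 1 + T 1 - T 2 - T 0 - T 0 - T 0 := by
    have h₂ : (T 2 : ℤ[T;T⁻¹]) = T 1 * T 1 := by rw [← LaurentPolynomial.T_add]; rfl
    rw [laurentW, h₂, LaurentPolynomial.T_zero]
    linear_combination (-1 : ℤ[T;T⁻¹]) * T_one_mul_T_neg_one
  rw [lam_apply, h]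
  simp [LaurentPolynomial.T_apply]

theorem lam_laurentW_sq : lam (laurentW ^ 2) = 10 := by
  have h : (1 - T 1) * laurentW ^ 2 =
      ((10 : ℕ) • T 0 - (10 : ℕ) • T 1 + (5 : ℕ) • T 2 - T 3 - (5 : ℕ) • T (-1) + T (-2)) := by
    have h₂ : (T 2 : ℤ[T;T⁻¹]) = T 1 ^ 2 := by rw [LaurentPolynomial.T_pow]; rfl
    have h₃ : (T 3 : ℤ[T;T⁻¹]) = T 1 ^ 3 := by rw [LaurentPolynomial.T_pow]; rfl
    have h₄ : (T (-2) : ℤ[T;T⁻¹]) = T (-1) ^ 2 := by rw [LaurentPolynomial.T_pow]; rfl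
    rw [laurentW, h₂, h₃, h₄, LaurentPolynomial.T_zero]
    simp only [nsmul_eq_mul]
    push_cast
    linear_combination ((6 : ℤ[T;T⁻¹]) - 2 * T 1 - T (-1)) * T_one_mul_T_neg_one
  rw [lam_apply, h]
  simp [LaurentPolynomial.T_apply, -nsmul_eq_mul]

theorem prod_range_two_mul {A : Type*} [CommMonoid A] (f : ℕ → A) (M : ℕ) :
    ∏ j ∈ Finset.range (2 * M), f j = ∏ j ∈ Finset.range M, f j * f (2 * M - 1 - j) := by
  rw [two_mul, Finset.prod_range_add, Finset.prod_mul_distrib,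
    ← Finset.prod_range_reflect (fun j => f (M + j))]
  congr 1
  refine Finset.prod_congr rfl fun j hj => ?_
  rw [Finset.mem_range] at hj
  congr 1
  omega

theorem v_succ (M : ℕ) :
    v (M + 1) = lam (∏ j ∈ Finset.range M,
      (((2 * M - 1 : ℤ) : ℤ[T;T⁻¹]) ^ 2 + (j * (2 * M - 1 - j) : ℤ) * laurentW)) := by
  have hT : (T M : ℤ[T;T⁻¹]) = ∏ j ∈ Finset.range M, T 1 := by
    rw [Finset.prod_const, Finset.card_range, LaurentPolynomial.T_pow, mul_one]
  have hC (n : ℤ) : (LaurentPolynomial.C n : ℤ[T;T⁻¹]) = n := eq_intCast _ n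
  have hP : Polynomial.toLaurent ((1 - X) * ∏ j ∈ Finset.range (2 * (M + 1) - 2),
      (Polynomial.C ((2 * (M + 1 : ℕ) : ℤ) - 3 - (j : ℤ)) + Polynomial.C (j : ℤ) * X)) =
      ((1 - T 1) * ∏ j ∈ Finset.range M,
      (((2 * M - 1 : ℤ) : ℤ[T;T⁻¹]) ^ 2 + (j * (2 * M - 1 - j) : ℤ) * laurentW)) * T M := by
    rw [hT, mul_assoc, ← Finset.prod_mul_distrib, show 2 * (M + 1) - 2 = 2 * M by omega,
      prod_range_two_mul, map_mul, map_prod]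
    congr 1
    · simp
    · refine Finset.prod_congr rfl fun j hj => ?_
      rw [Finset.mem_range] at hj
      have hc : ((2 * M - 1 - j : ℕ) : ℤ) = 2 * M - 1 - j := by omega
      rw [hc]
      simp only [map_mul, map_add, Polynomial.toLaurent_C, Polynomial.toLaurent_X, laurentW,
        hC]
      push_cast
      linear_combination (-(j * (2 * M - 1 - j) : ℤ[T;T⁻¹])) * T_one_mul_T_neg_one
  have hcoeff (f : ℤ[X]) (n : ℕ) : (Polynomial.toLaurent f).coeff n = f.coeff n := by
    rw [LaurentPolynomial.coeff_toLaurent, ← Polynomial.toFinsupp_apply]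
    exact Finsupp.mapDomain_apply Nat.castEmbedding.injective _ n
  rw [v, if_neg (by omega), ← hcoeff, hP, lam_apply, LaurentPolynomial.T.eq_def (M : ℤ),
    AddMonoidAlgebra.coeff_mul_single_apply, mul_one, Nat.add_sub_cancel, add_neg_cancel]

theorem prod_congr_two_pow (r m : ℕ) (D D' : ℤ) (h : (2 : ℤ) ^ r ∣ D' - D) :
    (2 : ℤ[T;T⁻¹]) ^ r ∣
      ∏ j ∈ Finset.range m, ((D' : ℤ[T;T⁻¹]) ^ 2 + (j * (D' - j) : ℤ) * laurentW) -
      ∏ j ∈ Finset.range m, ((D : ℤ[T;T⁻¹]) ^ 2 + (j * (D - j) : ℤ) * laurentW) := by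
  refine dvd_prod_sub_prod _ fun j _ => ?_
  obtain ⟨k, hk⟩ := h
  obtain rfl : D' = D + 2 ^ r * k := by linarith
  refine ⟨k * (2 * D + 2 ^ r * k) + j * k * laurentW, ?_⟩
  push_cast
  ring

theorem two_dvd_prod_sub_one (m : ℕ) (D : ℤ) (hD : Odd D) :
    (2 : ℤ[T;T⁻¹]) ∣
      ∏ j ∈ Finset.range m, ((D : ℤ[T;T⁻¹]) ^ 2 + (j * (D - j) : ℤ) * laurentW) - 1 := by
  suffices h : ∀ j ∈ Finset.range m,
      (2 : ℤ[T;T⁻¹]) ∣ ((D : ℤ[T;T⁻¹]) ^ 2 + (j * (D - j) : ℤ) * laurentW) - 1 by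
    simpa using dvd_prod_sub_prod _ h
  intro j _
  obtain ⟨e, rfl⟩ := hD
  obtain ⟨k, hk⟩ : (2 : ℤ) ∣ j * (2 * e + 1 - j) := by
    rw [← even_iff_two_dvd]; grind
  refine ⟨2 * e + 2 * e ^ 2 + k * laurentW, ?_⟩
  rw [hk]
  push_cast
  ring

theorem lam_modEq {r : ℕ} {f g c : ℤ[T;T⁻¹]} {n : ℤ}
    (h : f = g + 2 ^ r * (laurentW + n * laurentW ^ 2) + 2 ^ (r + 1) * c) :
    lam f ≡ lam g + 2 ^ r [ZMOD 2 ^ (r + 1)] := by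
  rw [h, map_add, map_add, lam_two_pow_mul, lam_two_pow_mul, map_add, lam_intCast_mul,
    lam_laurentW, lam_laurentW_sq]
  refine (Int.modEq_iff_dvd.2 ⟨2 - 5 * n - lam c, ?_⟩)
  ring

/-- An approximate inverse of `9 + 2 * laurentW = (1 + 2 * T) * (1 + 2 * T⁻¹)`. -/
theorem exists_approx_inverse (N : ℕ) :
    ∃ B b k : ℤ[T;T⁻¹], (9 + 2 * laurentW) * B = 1 + 2 ^ N * k ∧ B = -1 + 2 * b ∧
      lam B = -1 := by
  suffices h : ∃ B b P Q : ℤ[T;T⁻¹],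
      (9 + 2 * laurentW) * B = 1 + (-2) ^ (N + 1) * Q - (-2) ^ (N + 2) * P ∧ B = -1 + 2 * b ∧
      lam B = -1 ∧ (1 - T 1) * P = T (-N) - T (N + 1) ∧
      (1 - T 1) * Q = T (-(N + 1)) - T (N + 2) by
    obtain ⟨B, b, P, Q, h, hb, hB, -, -⟩ := h
    refine ⟨B, b, (-1) ^ N * (-2 * Q - 4 * P), ?_, hb, hB⟩
    rw [h, pow_succ, pow_add, neg_pow 2 N]
    ring
  induction N with
  | zero =>
    refine ⟨-1, 0, 1, laurentW + 3, by ring, by ring, by rw [map_neg, lam_one], by simp, ?_⟩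
    have h₂ : (T (2) : ℤ[T;T⁻¹]) = T 1 * T 1 := by rw [← LaurentPolynomial.T_add]; rfl
    simp only [laurentW, Nat.cast_zero, zero_add, h₂]
    linear_combination (-1 : ℤ[T;T⁻¹]) * T_one_mul_T_neg_one
  | succ N ih =>
    obtain ⟨B, b, P, Q, h, hb, hB, hP, hQ⟩ := ih
    refine ⟨B - (-2) ^ (N + 1) * Q, b + (-2) ^ N * Q, Q, (laurentW + 2) * Q - P,
      ?_, ?_, ?_, ?_, ?_⟩
    · rw [mul_sub, h]; ring
    · rw [hb]; ring
    · have hQ₀ : lam Q = 0 := by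
        rw [lam_apply, hQ]
        simp only [AddMonoidAlgebra.coeff_sub, Finsupp.sub_apply, LaurentPolynomial.T_apply]
        rw [if_neg (by omega), if_neg (by omega), sub_zero]
      have := lam_intCast_mul ((-2) ^ (N + 1)) Q
      push_cast at this
      rw [map_sub, this, hQ₀, hB, mul_zero, sub_zero]
    · rw [hQ]; push_cast; ring_nf
    · have h₁ : (T (-((N + 1 : ℕ) + 1 : ℤ)) : ℤ[T;T⁻¹]) = T (-(N + 1)) * T (-1) := by
        rw [← LaurentPolynomial.T_add]; push_cast; ring_nf
      have h₂ : (T ((N + 1 : ℕ) + 2 : ℤ) : ℤ[T;T⁻¹]) = T (N + 2) * T 1 := by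
        rw [← LaurentPolynomial.T_add]; push_cast; ring_nf
      have h₃ : (T (-N) : ℤ[T;T⁻¹]) = T (-(N + 1)) * T 1 := by
        rw [← LaurentPolynomial.T_add]; ring_nf
      have h₄ : (T (N + 1) : ℤ[T;T⁻¹]) = T (N + 2) * T (-1) := by
        rw [← LaurentPolynomial.T_add]; ring_nf
      rw [h₃, h₄] at hP
      rw [h₁, h₂, laurentW]
      linear_combination (T 1 + T (-1)) * hQ - hP

theorem v_two_pow_add_modEq {r : ℕ} (hr : 1 ≤ r) (i : ℕ) :
    v (2 ^ r + i) ≡ v i + 2 ^ r [ZMOD 2 ^ (r + 1)] := by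
  obtain _ | M := i
  · obtain ⟨m, hm⟩ : ∃ m, 2 ^ r = m + 1 := Nat.exists_eq_succ_of_ne_zero (by positivity)
    obtain ⟨n, c, hc⟩ := exists_prod_range_two_pow_eq_of_pos laurentW 2 (-1) hr
    obtain ⟨B, b, k, hk, hb, hB⟩ := exists_approx_inverse (r + 1)
    have hm' : (2 : ℤ) ^ r = m + 1 := by exact_mod_cast hm
    obtain ⟨f, hf⟩ := prod_congr_two_pow (r + 1) m (-3) (2 * m - 1)
      ⟨1, by rw [pow_succ, hm']; ring⟩
    set F := ∏ j ∈ Finset.range m,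
      (((-3 : ℤ) : ℤ[T;T⁻¹]) ^ 2 + (j * (-3 - j) : ℤ) * laurentW) with hF
    have hFc : F * (9 + 2 * laurentW) =
        1 + 2 ^ r * (laurentW + n * laurentW ^ 2) + 2 ^ (r + 1) * c := by
      rw [← hc, hm, Finset.prod_range_succ', hF]
      congr 1
      · refine Finset.prod_congr rfl fun j _ => ?_
        push_cast; ring
      · push_cast; ring
    have hv : v 0 = lam B := by rw [hB, v, if_pos rfl]
    rw [add_zero, hm, v_succ, hv]
    refine lam_modEq (n := n) (c := f + b * (laurentW + n * laurentW ^ 2) -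
      (laurentW + n * laurentW ^ 2) + B * c - F * k) ?_
    rw [sub_eq_iff_eq_add.1 hf]
    linear_combination (-F) * hk + B * hFc + 2 ^ r * (laurentW + n * laurentW ^ 2) * hb
  · obtain ⟨n, c, hc⟩ := exists_prod_range_two_pow_eq_of_pos laurentW ((M : ℤ) ^ 2 - M) M hr
    obtain ⟨f, hf⟩ := prod_congr_two_pow (r + 1) (M + 2 ^ r) (2 * M - 1)
      (2 * (M + 2 ^ r : ℕ) - 1) ⟨1, by push_cast; ring⟩
    obtain ⟨g, hg⟩ := two_dvd_prod_sub_one M (2 * M - 1) ⟨M - 1, by ring⟩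
    rw [show 2 ^ r + (M + 1) = M + 2 ^ r + 1 by ring, v_succ, v_succ, sub_eq_iff_eq_add.1 hf,
      Finset.prod_range_add]
    set F := ∏ j ∈ Finset.range M,
      (((2 * M - 1 : ℤ) : ℤ[T;T⁻¹]) ^ 2 + (j * (2 * M - 1 - j) : ℤ) * laurentW)
    have hG : ∏ t ∈ Finset.range (2 ^ r), (((2 * M - 1 : ℤ) : ℤ[T;T⁻¹]) ^ 2 +
        ((M + t : ℕ) * (2 * M - 1 - (M + t : ℕ)) : ℤ) * laurentW) =
        1 + 2 ^ r * (laurentW + n * laurentW ^ 2) + 2 ^ (r + 1) * c := by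
      rw [← hc]
      refine Finset.prod_congr rfl fun t _ => ?_
      push_cast; ring
    rw [hG]
    refine lam_modEq (n := n) (c := f + F * c + g * (laurentW + n * laurentW ^ 2)) ?_
    linear_combination 2 ^ r * (laurentW + n * laurentW ^ 2) * hg

end LaurentFunctional

theorem v_two_pow_add_modEq_self {q : ℕ} (hq : 1 ≤ q) (i : ℕ) :
    v (2 ^ q + i) ≡ v i [ZMOD 2 ^ q] := by
  have h := (v_two_pow_add_modEq hq i).of_dvd (pow_dvd_pow 2 q.le_succ)
  exact h.trans Int.add_modEq_right

theorem v_mul_two_pow_add_modEq {q : ℕ} (hq : 1 ≤ q) (i k : ℕ) :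
    v (k * 2 ^ q + i) ≡ v i [ZMOD 2 ^ q] := by
  induction k with
  | zero => simp [Int.ModEq.refl]
  | succ k ih =>
    rw [show (k + 1) * 2 ^ q + i = 2 ^ q + (k * 2 ^ q + i) by ring]
    exact (v_two_pow_add_modEq_self hq _).trans ih

theorem card_filter_v_modEq {q : ℕ} (hq : 1 ≤ q) {a : ℤ} (ha : Odd a) :
    ((Finset.Icc 1 (2 ^ q)).filter (fun j => v j ≡ a [ZMOD (2 : ℤ) ^ q])).card = 2 := by
  induction q, hq using Nat.le_induction with
  | base =>
    have h₁ : v 1 = 1 := by simp [v]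
    have h₂ : v 2 ≡ -1 [ZMOD 2] := by
      have := v_two_pow_add_modEq_self le_rfl 0
      simpa [v] using this
    rw [Finset.filter_true_of_mem]
    · simp
    · intro j hj
      rw [Finset.mem_Icc] at hj
      obtain rfl | rfl : j = 1 ∨ j = 2 := by omega
      · rw [h₁, pow_one]; simp only [Int.ModEq]; grind
      · rw [pow_one]; simp only [Int.ModEq] at *; grind
  | succ q hq ih =>
    have hsplit (f : ℕ → ℕ) : ∑ j ∈ Finset.Icc 1 (2 ^ (q + 1)), f j =
        ∑ j ∈ Finset.Icc 1 (2 ^ q), (f j + f (2 ^ q + j)) := by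
      have hIcc (n : ℕ) (g : ℕ → ℕ) :
          ∑ j ∈ Finset.Icc 1 n, g j = ∑ j ∈ Finset.range n, g (j + 1) := by
        rw [Finset.range_eq_Ico, Finset.sum_Ico_add' g, zero_add]
        rfl
      rw [hIcc, hIcc, pow_succ, mul_two, Finset.sum_range_add, Finset.sum_add_distrib]
      simp only [add_assoc]
    rw [Finset.card_filter, hsplit]
    refine Eq.trans ?_ ih
    rw [Finset.card_filter]
    refine Finset.sum_congr rfl fun j _ => ?_
    have hj := v_two_pow_add_modEq hq j
    have hpos : (0 : ℤ) < 2 ^ q := by positivity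
    have hiff : (v (2 ^ q + j) ≡ a [ZMOD 2 ^ (q + 1)]) ↔
        (v j + 2 ^ q ≡ a [ZMOD 2 ^ (q + 1)]) :=
      ⟨fun h => hj.symm.trans h, fun h => hj.trans h⟩
    simp only [hiff]
    simp only [Int.modEq_iff_dvd, pow_succ]
    by_cases h : (2 : ℤ) ^ q ∣ a - v j
    · rw [if_pos h]
      obtain ⟨k, hk⟩ := h
      have e₁ : a - (v j + 2 ^ q) = 2 ^ q * (k - 1) := by linear_combination hk
      rw [hk, e₁]
      simp only [Int.mul_dvd_mul_iff_left hpos.ne']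
      split_ifs <;> omega
    · rw [if_neg h, if_neg, if_neg]
      · rintro ⟨k, hk⟩
        exact h ⟨2 * k + 1, by linear_combination hk⟩
      · exact fun h' => h (dvd_of_mul_right_dvd h')

theorem v_two_pow_periodicity_equidistribution (q : ℕ) (hq : 1 ≤ q) :
    (∀ i k : ℕ, v (k * 2 ^ q + i) ≡ v i [ZMOD (2 : ℤ) ^ q]) ∧
    (2 ≤ q → ∀ i : ℕ, v (2 ^ (q - 1) + i) ≡ v i + 2 ^ (q - 1) [ZMOD (2 : ℤ) ^ q]) ∧
    (∀ a : ℤ, Odd a →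
      ((Finset.Icc 1 (2 ^ q)).filter
        (fun j => v j ≡ a [ZMOD (2 : ℤ) ^ q])).card = 2) := by
  refine ⟨v_mul_two_pow_add_modEq hq, fun h i => ?_, fun a => card_filter_v_modEq hq⟩
  obtain ⟨r, rfl⟩ : ∃ r, q = r + 1 := ⟨q - 1, by omega⟩
  exact v_two_pow_add_modEq (by omega) i
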